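/- For every constant c > 0 there exist a constant c' > 0 and infinitely many n for which there exists an n-vertex directed graph G with m edges with the following property: for every shortcut set H of G with |H| ≤ c·m, there exists a pair (s,t) with t reachable from s in G such that every path from s to t in G ∪ H has more than c'·n^{2/9} edges; that is, every shortcut set of size at most c·m leaves the diameter of G ∪ H at least c'·n^{2/9}. -/

import Mathlib

open Finset

/-- A walk in a directed edge set `F`, given as the list of visited vertices. -/
def IsWalkOn {V : Type} (F : Finset (V × V)) (s t : V) (l : List V) : Prop :=
  l.Chain' (fun a b => (a, b) ∈ F) ∧ l.head? = some s ∧ l.getLast? = some t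

def ReachableOn {V : Type} (F : Finset (V × V)) (s t : V) : Prop :=
  ∃ l, IsWalkOn F s t l

/-- A directed weighted graph: a finite set of directed edges together with weights. -/
structure WDigraph (V : Type) where
  Edge : Finset (V × V)
  w : V × V → ℝ

namespace WDigraph

variable {V : Type}

/-- Total weight of a walk (sum of weights of consecutive pairs). -/
def walkWeight (G : WDigraph V) (l : List V) : ℝ :=
  ((l.zip l.tail).map G.w).sum

/-- Distance from `s` to `t` using only edges of `F`, with weights of `G`. -/
noncomputable def distOn (G : WDigraph V) (F : Finset (V × V)) (s t : V) : ℝ :=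
  sInf {x | ∃ l, IsWalkOn F s t l ∧ G.walkWeight l = x}

def IsWalk (G : WDigraph V) (s t : V) (l : List V) : Prop :=
  IsWalkOn G.Edge s t l

def Reachable (G : WDigraph V) (s t : V) : Prop :=
  ReachableOn G.Edge s t

noncomputable def dist (G : WDigraph V) (s t : V) : ℝ :=
  G.distOn G.Edge s t

/-- All edge weights equal to `1`. -/
def Unweighted (G : WDigraph V) : Prop := ∀ e ∈ G.Edge, G.w e = 1

/-- All edge weights positive. -/
def PosWeights (G : WDigraph V) : Prop := ∀ e ∈ G.Edge, 0 < G.w e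

/-- `F` is (the edge set of) an exact distance preserver of `(G, P)`. -/
def IsExactPreserver (G : WDigraph V) (F : Finset (V × V)) (P : Finset (V × V)) : Prop :=
  F ⊆ G.Edge ∧ ∀ q ∈ P, ReachableOn F q.1 q.2 ∧ G.distOn F q.1 q.2 = G.dist q.1 q.2

/-- Total (in plus out) degree of a vertex. -/
def degree [DecidableEq V] (G : WDigraph V) (v : V) : ℕ :=
  (G.Edge.filter fun e => e.1 = v ∨ e.2 = v).card

end WDigraph

/-- The number whose `k` binary digits are the `k` lowest binary digits of `i`, reversed. -/
def bitRev : ℕ → ℕ → ℕ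
  | 0, _ => 0
  | k + 1, i => 2 ^ k * (i % 2) + bitRev k (i / 2)

lemma bitRev_lt (k i : ℕ) : bitRev k i < 2 ^ k := by
  induction k generalizing i with
  | zero => simp [bitRev]
  | succ k ih =>
    have h := ih (i / 2)
    have h2 : 2 ^ k * (i % 2) ≤ 2 ^ k * 1 := Nat.mul_le_mul_left _ (by omega)
    rw [bitRev, pow_succ]
    omega

/-- Every aligned block of `2 ^ j` indices realises all possible `j` leading digits of `bitRev`. -/
lemma exists_bitRev_div_eq {j k : ℕ} (hj : j ≤ k) (q : ℕ) {τ : ℕ} (hτ : τ < 2 ^ j) :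
    ∃ i, i / 2 ^ j = q ∧ bitRev k i / 2 ^ (k - j) = τ := by
  induction j generalizing k τ with
  | zero =>
    refine ⟨q, by simp, ?_⟩
    have := Nat.div_eq_of_lt (bitRev_lt k q)
    simp at hτ
    simpa [hτ] using this
  | succ j ih =>
    obtain ⟨k, rfl⟩ : ∃ k', k = k' + 1 := ⟨k - 1, by omega⟩
    have hjk : j ≤ k := by omega
    obtain ⟨i, hi, hr⟩ := ih hjk (Nat.mod_lt τ (Nat.two_pow_pos j))
    have hb : τ / 2 ^ j < 2 := Nat.div_lt_of_lt_mul (by rwa [pow_succ] at hτ)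
    have hdm := Nat.div_add_mod τ (2 ^ j)
    generalize τ / 2 ^ j = b at hb hdm
    refine ⟨2 * i + b, ?_, ?_⟩
    · rw [pow_succ', ← Nat.div_div_eq_div_mul, ← hi]
      congr 1
      omega
    · have e1 : (2 * i + b) % 2 = b := by omega
      have e2 : (2 * i + b) / 2 = i := by omega
      have e3 : 2 ^ k = 2 ^ (k - j) * 2 ^ j := by rw [← pow_add]; congr 1; omega
      rw [bitRev, e1, e2, Nat.add_sub_add_right, e3, mul_assoc,
        Nat.mul_add_div (Nat.two_pow_pos _), hr]
      exact hdm

/-- The number of indices below `i` at which the sequence `a` exceeds the threshold `α`. -/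
def countAbove (a : ℕ → ℕ) (α i : ℕ) : ℕ := ∑ j ∈ range i, if α < a j then 1 else 0

/-- The sum of the terms of index below `i` at which the sequence `a` exceeds `α`. -/
def sumAbove (a : ℕ → ℕ) (α i : ℕ) : ℕ := ∑ j ∈ range i, if α < a j then a j else 0

lemma countAbove_le (a : ℕ → ℕ) (α i : ℕ) : countAbove a α i ≤ i := by
  have h := Finset.sum_le_card_nsmul (range i) (fun j => if α < a j then 1 else 0) 1
    (fun j _ => by split_ifs <;> simp)
  simpa [countAbove] using h

lemma sumAbove_le {a : ℕ → ℕ} {M : ℕ} (ha : ∀ i, a i ≤ M) (α i : ℕ) :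
    sumAbove a α i ≤ i * M := by
  have h := Finset.sum_le_card_nsmul (range i) (fun j => if α < a j then a j else 0) M
    (fun j _ => by split_ifs <;> simp [ha])
  simpa [sumAbove] using h

/-- Two thresholds with the same number of exceedances in a window are not separated there. -/
lemma not_separated_of_countAbove_eq {a : ℕ → ℕ} {α α' p q Δ i : ℕ} (hα : α ≤ α')
    (h : countAbove a α q = countAbove a α p + Δ)
    (h' : countAbove a α' q = countAbove a α' p + Δ) (hp : p ≤ i) (hq : i < q)
    (hi : α < a i) : α' < a i := by
  have hpq : p ≤ q := hp.trans hq.le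
  have key : ∀ β, countAbove a β q = countAbove a β p +
      ∑ j ∈ Ico p q, if β < a j then 1 else 0 := fun β =>
    (Finset.sum_range_add_sum_Ico _ hpq).symm
  have hs : (∑ j ∈ Ico p q, if α' < a j then 1 else 0) =
      ∑ j ∈ Ico p q, if α < a j then 1 else 0 := by
    have h1 := key α
    have h2 := key α'
    omega
  have hle : ∀ j ∈ Ico p q, (if α' < a j then 1 else 0) ≤ (if α < a j then 1 else 0) := by
    intro j _
    split_ifs <;> omega
  have := (Finset.sum_eq_sum_iff_of_le hle).1 hs i (Finset.mem_Ico.2 ⟨hp, hq⟩)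
  by_contra hn
  simp [hn, hi] at this

lemma card_filter_countAbove_le {j k p q : ℕ} (hj : j ≤ k) (hpq : p + 2 ^ (j + 1) ≤ q) (Δ : ℕ) :
    ((range (2 ^ k)).filter fun α =>
      countAbove (bitRev k) α q = countAbove (bitRev k) α p + Δ).card ≤ 2 * 2 ^ (k - j) := by
  set S := (range (2 ^ k)).filter fun α =>
    countAbove (bitRev k) α q = countAbove (bitRev k) α p + Δ with hS
  set w := 2 ^ (k - j) with hw
  have hw0 : 0 < w := Nat.two_pow_pos _
  have hwk : 2 ^ k = w * 2 ^ j := by rw [hw, ← pow_add]; congr 1; omega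
  have gap : ∀ α ∈ S, ∀ α' ∈ S, α ≤ α' → α' < α + 2 * w := by
    intro α hα α' hα' hle
    rw [hS, Finset.mem_filter, Finset.mem_range] at hα hα'
    by_contra! hge
    have hdiv := Nat.div_add_mod α w
    have hmod := Nat.mod_lt α hw0
    have hτ : α / w + 1 < 2 ^ j := by
      have : w * (α / w + 1) < w * 2 ^ j := by
        rw [← hwk, mul_add]
        omega
      exact Nat.lt_of_mul_lt_mul_left this
    obtain ⟨i, hi, hr⟩ := exists_bitRev_div_eq hj (p / 2 ^ j + 1) hτ
    have h2 : 0 < 2 ^ j := Nat.two_pow_pos j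
    have hi1 := Nat.div_add_mod i (2 ^ j)
    have hi2 := Nat.mod_lt i h2
    have hp1 := Nat.div_add_mod p (2 ^ j)
    have hp2 := Nat.mod_lt p h2
    rw [hi, mul_add, mul_one] at hi1
    rw [pow_succ] at hpq
    have hr1 := Nat.div_add_mod (bitRev k i) w
    have hr2 := Nat.mod_lt (bitRev k i) hw0
    rw [hr, mul_add, mul_one] at hr1
    have := not_separated_of_countAbove_eq hle hα.2 hα'.2 (i := i) (by omega) (by omega)
      (by omega)
    omega
  rcases S.eq_empty_or_nonempty with h | h
  · simp [h]
  · have hsub : S ⊆ Ico (S.min' h) (S.min' h + 2 * w) := fun α hα =>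
      Finset.mem_Ico.2 ⟨S.min'_le α hα, gap _ (S.min'_mem h) _ hα (S.min'_le α hα)⟩
    simpa using Finset.card_le_card hsub

lemma sq_card_filter_countAbove_mul_le {k s p q : ℕ} (hL : p + 16 * 4 ^ s ≤ q)
    (hD : q ≤ p + 4 ^ k) (Δ Δ' : ℕ) :
    ((range (2 ^ (k + s))).filter fun α => countAbove (bitRev (k + s)) α q =
        countAbove (bitRev (k + s)) α p + Δ).card *
      ((range (2 ^ (k + s))).filter fun α => countAbove (bitRev (k + s)) α q =
        countAbove (bitRev (k + s)) α p + Δ').card * (q - p) ≤ 4 * 4 ^ k := by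
  obtain ⟨ℓ, rfl⟩ : ∃ ℓ, q = p + ℓ := ⟨q - p, by omega⟩
  rw [Nat.add_sub_cancel_left]
  have hs1 : 1 ≤ 4 ^ s := Nat.one_le_pow _ _ (by norm_num)
  have hℓL : 16 * 4 ^ s ≤ ℓ := by omega
  have hℓD : ℓ ≤ 4 ^ k := by omega
  have hℓ0 : ℓ ≠ 0 := by omega
  have hlog : Nat.log 2 ℓ ≠ 0 := by
    have := Nat.log_pos (b := 2) (by norm_num) (show 2 ≤ ℓ by omega)
    omega
  obtain ⟨j, hj⟩ := Nat.exists_eq_succ_of_ne_zero hlog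
  have hlo : 2 ^ (j + 1) ≤ ℓ := by
    have := Nat.pow_log_le_self 2 hℓ0
    rwa [hj] at this
  have hhi : ℓ < 2 ^ (j + 2) := by
    have := Nat.lt_pow_succ_log_self (b := 2) (by norm_num) ℓ
    rwa [hj] at this
  by_cases hjk : j ≤ k + s
  · have h1 := card_filter_countAbove_le (p := p) (q := p + ℓ) hjk (Nat.add_le_add_left hlo p) Δ
    have h2 := card_filter_countAbove_le (p := p) (q := p + ℓ) hjk (Nat.add_le_add_left hlo p) Δ'
    set w := 2 ^ (k + s - j) with hw
    have hww : w * w * 4 ^ j = 4 ^ s * 4 ^ k := by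
      have : w * 2 ^ j = 2 ^ (k + s) := by rw [hw, ← pow_add]; congr 1; omega
      calc w * w * 4 ^ j = (w * 2 ^ j) ^ 2 := by
            rw [show (4 : ℕ) = 2 ^ 2 by norm_num, ← pow_mul]; ring
        _ = 4 ^ s * 4 ^ k := by
            rw [this, show (4 : ℕ) = 2 ^ 2 by norm_num, ← pow_mul 2 2 s, ← pow_mul 2 2 k]; ring
    have hℓ2 : ℓ * ℓ ≤ 16 * 4 ^ j := by
      calc ℓ * ℓ ≤ 2 ^ (j + 2) * 2 ^ (j + 2) := Nat.mul_le_mul hhi.le hhi.le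
        _ = 16 * 4 ^ j := by
            rw [show (4 : ℕ) = 2 ^ 2 by norm_num, ← pow_mul]; ring
    have hmain : w * w * ℓ ≤ 4 ^ k := by
      refine le_of_mul_le_mul_left (a := 16 * 4 ^ s) ?_ (by positivity)
      calc 16 * 4 ^ s * (w * w * ℓ) ≤ ℓ * (w * w * ℓ) := Nat.mul_le_mul_right _ hℓL
        _ = w * w * (ℓ * ℓ) := by ring
        _ ≤ w * w * (16 * 4 ^ j) := Nat.mul_le_mul_left _ hℓ2
        _ = 16 * (w * w * 4 ^ j) := by ring
        _ = 16 * 4 ^ s * 4 ^ k := by rw [hww]; ring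
    calc _ ≤ (2 * w) * (2 * w) * ℓ := Nat.mul_le_mul_right _ (Nat.mul_le_mul h1 h2)
      _ = 4 * (w * w * ℓ) := by ring
      _ ≤ _ := Nat.mul_le_mul_left _ hmain
  · have hpow : 2 ^ (k + s + 1) ≤ ℓ :=
      (Nat.pow_le_pow_right (by norm_num) (by omega)).trans hlo
    have h1 := card_filter_countAbove_le (p := p) (q := p + ℓ) le_rfl (Nat.add_le_add_left hpow p) Δ
    have h2 := card_filter_countAbove_le (p := p) (q := p + ℓ) le_rfl (Nat.add_le_add_left hpow p) Δ'
    rw [Nat.sub_self, pow_zero, mul_one] at h1 h2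
    calc _ ≤ 2 * 2 * ℓ := Nat.mul_le_mul_right _ (Nat.mul_le_mul h1 h2)
      _ ≤ _ := by omega

/-- The displacement of a lattice point `(i, x, y, z)` in layer `i` from the point in layer `i` of
the critical path with thresholds `α`, `β` that starts at the origin. -/
def offset (a : ℕ → ℕ) (α β : ℕ) (v : ℕ × ℕ × ℕ × ℕ) : ℤ × ℤ × ℤ :=
  (v.2.1 - sumAbove a α v.1 - sumAbove a β v.1, v.2.2.1 - countAbove a α v.1,
    v.2.2.2 - countAbove a β v.1)

/-- The linear functional maximised by the critical paths with thresholds `α`, `β`. -/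
def potential (α β : ℕ) (d : ℤ × ℤ × ℤ) : ℤ :=
  2 * d.1 - (2 * α + 1) * d.2.1 - (2 * β + 1) * d.2.2

/-- The edges of the layered lattice graph determined by the sequence `a`. -/
def LatticeStep (a : ℕ → ℕ) (u v : ℕ × ℕ × ℕ × ℕ) : Prop :=
  ∃ e ∈ range 2, ∃ e' ∈ range 2,
    v = (u.1 + 1, u.2.1 + (e + e') * a u.1, u.2.2.1 + e, u.2.2.2 + e')

/-- From `u` to `v` the layer does not decrease, and the offset from the critical path with
thresholds `α`, `β` either stays the same or loses potential. -/
def Descends (a : ℕ → ℕ) (α β : ℕ) (u v : ℕ × ℕ × ℕ × ℕ) : Prop :=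
  u.1 ≤ v.1 ∧ (offset a α β v = offset a α β u ∨
    potential α β (offset a α β v) < potential α β (offset a α β u))

lemma Descends.refl (a : ℕ → ℕ) (α β : ℕ) (u : ℕ × ℕ × ℕ × ℕ) : Descends a α β u u :=
  ⟨le_rfl, Or.inl rfl⟩

lemma Descends.trans {a : ℕ → ℕ} {α β : ℕ} {u v w : ℕ × ℕ × ℕ × ℕ} (h : Descends a α β u v)
    (h' : Descends a α β v w) : Descends a α β u w := by
  refine ⟨h.1.trans h'.1, ?_⟩
  rcases h.2 with h1 | h1 <;> rcases h'.2 with h2 | h2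
  · exact Or.inl (h2.trans h1)
  · exact Or.inr (h1 ▸ h2)
  · exact Or.inr (h2 ▸ h1)
  · exact Or.inr (h2.trans h1)

lemma LatticeStep.descends {a : ℕ → ℕ} {u v : ℕ × ℕ × ℕ × ℕ} (h : LatticeStep a u v)
    (α β : ℕ) : Descends a α β u v := by
  obtain ⟨e, he, e', he', rfl⟩ := h
  obtain ⟨i, x, y, z⟩ := u
  rw [Finset.mem_range] at he he'
  refine ⟨Nat.le_succ _, ?_⟩
  simp only [offset, potential, sumAbove, countAbove, Finset.sum_range_succ, Prod.mk.injEq]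
  rcases Nat.lt_or_ge α (a i) with h1 | h1 <;> rcases Nat.lt_or_ge β (a i) with h2 | h2 <;>
    interval_cases e <;> interval_cases e' <;>
    simp only [h1, h2, h1.not_gt, h2.not_gt, if_true, if_false] <;> push_cast <;>
    zify at h1 h2 <;>
    first
    | exact Or.inl ⟨by ring1, by ring1, by ring1⟩
    | exact Or.inr (by linarith)

lemma countAbove_mono (a : ℕ → ℕ) (α : ℕ) : Monotone (countAbove a α) := fun _ _ h =>
  Finset.sum_le_sum_of_subset (Finset.range_mono h)

lemma reachableOn_refl {V : Type} (F : Finset (V × V)) (s : V) : ReachableOn F s s :=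
  ⟨[s], List.isChain_singleton s, rfl, rfl⟩

lemma ReachableOn.tail {V : Type} {F : Finset (V × V)} {s t u : V} (h : ReachableOn F s t)
    (htu : (t, u) ∈ F) : ReachableOn F s u := by
  obtain ⟨l, hc, hs, ht⟩ := h
  refine ⟨l ++ [u], ?_, ?_, by simp⟩
  · refine List.IsChain.append hc (List.isChain_singleton u) ?_
    intro x hx y hy
    rw [ht] at hx
    simp at hx hy
    subst hx hy
    exact htu
  · simp [hs]

lemma isWalkOn_iff {V : Type} {F : Finset (V × V)} {s t : V} {l : List V} :
    IsWalkOn F s t l ↔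
      l.IsChain (fun a b => (a, b) ∈ F) ∧ l.head? = some s ∧ l.getLast? = some t :=
  Iff.rfl

lemma isWalkOn_singleton {V : Type} {F : Finset (V × V)} {s t x : V} :
    IsWalkOn F s t [x] ↔ x = s ∧ x = t := by
  simp [isWalkOn_iff]

lemma isWalkOn_cons_cons {V : Type} {F : Finset (V × V)} {s t x y : V} {l : List V} :
    IsWalkOn F s t (x :: y :: l) ↔ x = s ∧ (s, y) ∈ F ∧ IsWalkOn F y t (y :: l) := by
  simp only [isWalkOn_iff, List.isChain_cons_cons, List.head?_cons, Option.some.injEq,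
    List.getLast?_cons_cons]
  constructor
  · rintro ⟨⟨h1, h2⟩, rfl, h3⟩
    exact ⟨rfl, h1, h2, trivial, h3⟩
  · rintro ⟨rfl, h1, h2, -, h3⟩
    exact ⟨⟨h1, h2⟩, rfl, h3⟩

lemma IsWalkOn.descends {V : Type} {F : Finset (V × V)} {pos : V → ℕ × ℕ × ℕ × ℕ} {a : ℕ → ℕ}
    {α β : ℕ} (hF : ∀ e ∈ F, Descends a α β (pos e.1) (pos e.2)) {l : List V} {s t : V}
    (h : IsWalkOn F s t l) : Descends a α β (pos s) (pos t) := by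
  induction l generalizing s with
  | nil => simp [IsWalkOn] at h
  | cons x l ih =>
    cases l with
    | nil =>
      obtain ⟨rfl, rfl⟩ := isWalkOn_singleton.1 h
      exact Descends.refl _ _ _ _
    | cons y l =>
      obtain ⟨-, h1, h2⟩ := isWalkOn_cons_cons.1 h
      exact (hF _ h1).trans (ih h2)

/-- A walk between two vertices of the same critical path can only use edges of that path, so the
layers it climbs are accounted for by its steps shorter than `L` and by the long shortcuts with
both endpoints on the critical path. -/
lemma IsWalkOn.layer_le {V : Type} [DecidableEq V] {E H : Finset (V × V)}
    {pos : V → ℕ × ℕ × ℕ × ℕ} {a : ℕ → ℕ} {α β L : ℕ} (hL : 2 ≤ L)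
    (hE : ∀ e ∈ E, LatticeStep a (pos e.1) (pos e.2))
    (hH : ∀ e ∈ H, Descends a α β (pos e.1) (pos e.2)) (o : ℤ × ℤ × ℤ) {l : List V} {s t : V}
    (h : IsWalkOn (E ∪ H) s t l) (hs : offset a α β (pos s) = o)
    (ht : offset a α β (pos t) = o) :
    (pos t).1 ≤ (pos s).1 + L * (l.length - 1) +
      ∑ e ∈ H with (offset a α β (pos e.1) = o ∧ offset a α β (pos e.2) = o ∧
        (pos e.1).1 + L ≤ (pos e.2).1) ∧ (pos s).1 ≤ (pos e.1).1,
        ((pos e.2).1 - (pos e.1).1) := by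
  have hF : ∀ e ∈ E ∪ H, Descends a α β (pos e.1) (pos e.2) := fun e he =>
    (Finset.mem_union.1 he).elim (fun h => (hE e h).descends α β) (hH e)
  induction l generalizing s with
  | nil => simp [IsWalkOn] at h
  | cons x l ih =>
    cases l with
    | nil =>
      obtain ⟨rfl, rfl⟩ := isWalkOn_singleton.1 h
      omega
    | cons y l =>
      obtain ⟨-, h1, h2⟩ := isWalkOn_cons_cons.1 h
      have d1 := hF _ h1
      have d2 := h2.descends hF
      have hy : offset a α β (pos y) = o := by
        rcases d1.2 with h | h
        · exact h.trans hs
        · rcases d2.2 with h' | h'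
          · exact h'.symm.trans ht
          · exact absurd (h'.trans h) (by simp only [hs, ht]; exact lt_irrefl _)
      have key := ih h2 hy
      have hlay : (pos s).1 ≤ (pos y).1 := d1.1
      simp only [List.length_cons, Nat.add_sub_cancel] at key ⊢
      rw [mul_add]
      by_cases hlong : (pos s).1 + L ≤ (pos y).1
      · have hmem : (s, y) ∈ H := by
          rcases Finset.mem_union.1 h1 with h | h
          · obtain ⟨e, he, e', he', h⟩ := hE _ h
            have h := congrArg Prod.fst h
            simp only at h
            omega
          · exact h
        have hsub : insert (s, y) {e ∈ H | (offset a α β (pos e.1) = o ∧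
            offset a α β (pos e.2) = o ∧ (pos e.1).1 + L ≤ (pos e.2).1) ∧
            (pos y).1 ≤ (pos e.1).1} ⊆ {e ∈ H | (offset a α β (pos e.1) = o ∧
            offset a α β (pos e.2) = o ∧ (pos e.1).1 + L ≤ (pos e.2).1) ∧
            (pos s).1 ≤ (pos e.1).1} := by
          intro e he
          rcases Finset.mem_insert.1 he with rfl | he
          · exact Finset.mem_filter.2 ⟨hmem, ⟨hs, hy, hlong⟩, le_rfl⟩
          · rw [Finset.mem_filter] at he ⊢
            exact ⟨he.1, he.2.1, hlay.trans he.2.2⟩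
        have hsum := Finset.sum_le_sum_of_subset (f := fun e : V × V =>
          (pos e.2).1 - (pos e.1).1) hsub
        rw [Finset.sum_insert (by simp only [Finset.mem_filter]; omega)] at hsum
        simp only at hsum
        omega
      · have hsub := Finset.sum_le_sum_of_subset (f := fun e : V × V =>
          (pos e.2).1 - (pos e.1).1) (Finset.monotone_filter_right H
          (p := fun e => (offset a α β (pos e.1) = o ∧ offset a α β (pos e.2) = o ∧
            (pos e.1).1 + L ≤ (pos e.2).1) ∧ (pos y).1 ≤ (pos e.1).1)
          (q := fun e => (offset a α β (pos e.1) = o ∧ offset a α β (pos e.2) = o ∧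
            (pos e.1).1 + L ≤ (pos e.2).1) ∧ (pos s).1 ≤ (pos e.1).1)
          (fun e _ he => ⟨he.1, hlay.trans he.2⟩))
        omega

/-- A shortcut spanning many layers lies on few critical paths. -/
lemma card_filter_offset_mul_le {k s : ℕ} (S : Finset (ℕ × ℕ × ℕ)) {u v : ℕ × ℕ × ℕ × ℕ}
    (hL : u.1 + 16 * 4 ^ s ≤ v.1) (hD : v.1 ≤ 4 ^ k) :
    ((S ×ˢ range (2 ^ (k + s)) ×ˢ range (2 ^ (k + s))).filter fun c =>
      offset (bitRev (k + s)) c.2.1 c.2.2 u = (↑c.1.1, ↑c.1.2.1, ↑c.1.2.2) ∧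
      offset (bitRev (k + s)) c.2.1 c.2.2 v = (↑c.1.1, ↑c.1.2.1, ↑c.1.2.2)).card *
      (v.1 - u.1) ≤ 4 * 4 ^ k := by
  refine le_trans (Nat.mul_le_mul_right _ ?_) (sq_card_filter_countAbove_mul_le hL
    (by omega) (v.2.2.1 - u.2.2.1) (v.2.2.2 - u.2.2.2))
  rw [← Finset.card_product]
  refine Finset.card_le_card_of_injOn (fun c => c.2) ?_ ?_
  · rintro ⟨⟨x, y, z⟩, α, β⟩ hc
    simp only [Finset.coe_filter, Finset.mem_product, Finset.mem_range, Set.mem_ofPred_eq,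
      offset, Prod.mk.injEq, Finset.coe_product, Set.mem_prod] at hc ⊢
    have h1 := countAbove_mono (bitRev (k + s)) α (show u.1 ≤ v.1 by omega)
    have h2 := countAbove_mono (bitRev (k + s)) β (show u.1 ≤ v.1 by omega)
    refine ⟨⟨hc.1.2.1, ?_⟩, hc.1.2.2, ?_⟩ <;> omega
  · rintro ⟨⟨x, y, z⟩, α, β⟩ hc ⟨⟨x', y', z'⟩, α', β'⟩ hc' h
    simp only [Finset.coe_filter, Set.mem_ofPred_eq, Prod.mk.injEq] at hc hc' h ⊢
    obtain ⟨rfl, rfl⟩ := h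
    have h := hc.2.1.symm.trans hc'.2.1
    simp only [Prod.mk.injEq, Nat.cast_inj] at h
    exact ⟨h, rfl, rfl⟩

/-- The vertex set of the layered lattice graph with `D` steps of length at most `N`. -/
def latticeBox (D N : ℕ) : Finset (ℕ × ℕ × ℕ × ℕ) :=
  range (D + 1) ×ˢ range (4 * D * N) ×ˢ range (2 * D) ×ˢ range (2 * D)

/-- The start points of the critical paths. -/
def startBox (D N : ℕ) : Finset (ℕ × ℕ × ℕ) := range (2 * D * N) ×ˢ range D ×ˢ range D

/-- The point in layer `i` of the critical path from `p` with thresholds `α`, `β`. -/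
def pathPoint (a : ℕ → ℕ) (α β : ℕ) (p : ℕ × ℕ × ℕ) (i : ℕ) : ℕ × ℕ × ℕ × ℕ :=
  (i, p.1 + sumAbove a α i + sumAbove a β i, p.2.1 + countAbove a α i,
    p.2.2 + countAbove a β i)

lemma offset_pathPoint (a : ℕ → ℕ) (α β : ℕ) (p : ℕ × ℕ × ℕ) (i : ℕ) :
    offset a α β (pathPoint a α β p i) = (↑p.1, ↑p.2.1, ↑p.2.2) := by
  simp only [offset, pathPoint, Prod.mk.injEq]
  push_cast
  exact ⟨by ring, by ring, by ring⟩

lemma latticeStep_pathPoint (a : ℕ → ℕ) (α β : ℕ) (p : ℕ × ℕ × ℕ) (i : ℕ) :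
    LatticeStep a (pathPoint a α β p i) (pathPoint a α β p (i + 1)) := by
  refine ⟨if α < a i then 1 else 0, by split_ifs <;> simp,
    if β < a i then 1 else 0, by split_ifs <;> simp, ?_⟩
  simp only [pathPoint, sumAbove, countAbove, Finset.sum_range_succ, Prod.mk.injEq, true_and]
  refine ⟨?_, by ring, by ring⟩
  split_ifs <;> ring

lemma pathPoint_mem_latticeBox {a : ℕ → ℕ} {D N : ℕ} (ha : ∀ i, a i ≤ N) (α β : ℕ)
    {p : ℕ × ℕ × ℕ} (hp : p ∈ startBox D N) {i : ℕ} (hi : i ≤ D) :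
    pathPoint a α β p i ∈ latticeBox D N := by
  simp only [startBox, latticeBox, pathPoint, Finset.mem_product, Finset.mem_range] at hp ⊢
  have h1 := sumAbove_le ha α i
  have h2 := sumAbove_le ha β i
  have h3 := countAbove_le a α i
  have h4 := countAbove_le a β i
  have h5 : i * N ≤ D * N := Nat.mul_le_mul_right _ hi
  have e1 : 2 * D * N = 2 * (D * N) := by ring
  have e2 : 4 * D * N = 4 * (D * N) := by ring
  omega

lemma card_edges_le {n : ℕ} {a : ℕ → ℕ} {pos : Fin n → ℕ × ℕ × ℕ × ℕ}
    (hpos : Function.Injective pos) {E : Finset (Fin n × Fin n)}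
    (hE : ∀ e ∈ E, LatticeStep a (pos e.1) (pos e.2)) : E.card ≤ 4 * n := by
  have h : E.card ≤ ((univ : Finset (Fin n)) ×ˢ range 2 ×ˢ range 2).card := by
    refine Finset.card_le_card_of_injOn (fun e => (e.1,
      (pos e.2).2.2.1 - (pos e.1).2.2.1, (pos e.2).2.2.2 - (pos e.1).2.2.2)) ?_ ?_
    · intro q hq
      obtain ⟨e, he, e', he', h⟩ := hE q hq
      simpa [h] using And.intro (Finset.mem_range.1 he) (Finset.mem_range.1 he')
    · rintro ⟨u, v⟩ hq ⟨u', v'⟩ hq' h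
      obtain ⟨e, he, e', he', h1⟩ := hE _ hq
      obtain ⟨f, hf, f', hf', h2⟩ := hE _ hq'
      simp only [Prod.mk.injEq] at h h1 h2 ⊢
      obtain ⟨rfl, h3, h4⟩ := h
      refine ⟨rfl, hpos ?_⟩
      rw [h1, h2] at h3 h4
      simp only [Nat.add_sub_cancel_left] at h3 h4
      rw [h1, h2, h3, h4]
  simpa [mul_comm] using h

/-- A shortcut set reducing the diameter of the layered lattice graph by a large constant factor
is at least proportional to the number of critical paths. -/
lemma card_criticalPaths_le {n k s : ℕ} {pos : Fin n → ℕ × ℕ × ℕ × ℕ}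
    (hpos : Function.Injective pos) (hmem : ∀ v, pos v ∈ latticeBox (4 ^ k) (2 ^ (k + s)))
    (hsurj : ∀ p ∈ latticeBox (4 ^ k) (2 ^ (k + s)), ∃ v, pos v = p)
    {E H : Finset (Fin n × Fin n)}
    (hE : ∀ e, e ∈ E ↔ LatticeStep (bitRev (k + s)) (pos e.1) (pos e.2))
    (hH : ∀ e ∈ H, ReachableOn E e.1 e.2)
    (hshort : ∀ u v, ReachableOn E u v →
      ∃ l, IsWalkOn (E ∪ H) u v l ∧ 2 * (16 * 4 ^ s * (l.length - 1)) ≤ 4 ^ k) :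
    (startBox (4 ^ k) (2 ^ (k + s))).card * (2 ^ (k + s) * 2 ^ (k + s)) ≤ 8 * H.card := by
  set a := bitRev (k + s) with ha
  set D := 4 ^ k with hD
  set L := 16 * 4 ^ s with hL
  have hD0 : 0 < D := by positivity
  have hL2 : 2 ≤ L := by
    have : 1 ≤ 4 ^ s := Nat.one_le_pow _ _ (by norm_num)
    omega
  have haN : ∀ i, a i ≤ 2 ^ (k + s) := fun i => (bitRev_lt _ _).le
  set I := startBox D (2 ^ (k + s)) ×ˢ range (2 ^ (k + s)) ×ˢ range (2 ^ (k + s)) with hI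
  let long : (ℕ × ℕ × ℕ) × (ℕ × ℕ) → Fin n × Fin n → Prop := fun c e =>
    offset a c.2.1 c.2.2 (pos e.1) = (↑c.1.1, ↑c.1.2.1, ↑c.1.2.2) ∧
      offset a c.2.1 c.2.2 (pos e.2) = (↑c.1.1, ↑c.1.2.1, ↑c.1.2.2) ∧
      (pos e.1).1 + L ≤ (pos e.2).1
  classical
  have hcover : ∀ c ∈ I, D ≤ 2 * ∑ e ∈ H with long c e, ((pos e.2).1 - (pos e.1).1) := by
    rintro ⟨p, α, β⟩ hc
    have hp : p ∈ startBox D (2 ^ (k + s)) := (Finset.mem_product.1 hc).1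
    have hHd : ∀ e ∈ H, Descends a α β (pos e.1) (pos e.2) := by
      intro e he
      obtain ⟨l, hl⟩ := hH e he
      exact hl.descends fun e he => ((hE e).1 he).descends α β
    have hpt : ∀ i ≤ D, ∃ v, pos v = pathPoint a α β p i := fun i hi =>
      hsurj _ (pathPoint_mem_latticeBox haN α β hp hi)
    obtain ⟨u, hu⟩ := hpt 0 (Nat.zero_le _)
    have hreach : ∀ i ≤ D, ∀ v, pos v = pathPoint a α β p i → ReachableOn E u v := by
      intro i
      induction i with
      | zero =>
        intro _ v hv
        rw [hpos (hv.trans hu.symm)]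
        exact reachableOn_refl E u
      | succ i ih =>
        intro hi v hv
        obtain ⟨w, hw⟩ := hpt i (by omega)
        refine (ih (by omega) w hw).tail ((hE _).2 ?_)
        rw [hw, hv]
        exact latticeStep_pathPoint a α β p i
    obtain ⟨v, hv⟩ := hpt D le_rfl
    obtain ⟨l, hl, hlen⟩ := hshort u v (hreach D le_rfl v hv)
    have key := hl.layer_le hL2 (fun e he => (hE e).1 he) hHd _
      (by rw [hu, offset_pathPoint]) (by rw [hv, offset_pathPoint])
    rw [hu, hv] at key
    simp only [pathPoint, Nat.zero_le, and_true, zero_add] at key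
    simp only [long]
    omega
  have hfew : ∀ e ∈ H, ∑ c ∈ I with long c e, ((pos e.2).1 - (pos e.1).1) ≤ 4 * D := by
    intro e _
    rw [Finset.sum_const, smul_eq_mul]
    by_cases hlong : (pos e.1).1 + L ≤ (pos e.2).1
    · have hle : (pos e.2).1 ≤ D := by
        have := (Finset.mem_product.1 (hmem e.2)).1
        rw [Finset.mem_range] at this
        omega
      refine le_trans (Nat.mul_le_mul_right _ (Finset.card_le_card ?_))
        (card_filter_offset_mul_le (startBox D (2 ^ (k + s))) hlong hle)
      exact Finset.monotone_filter_right _ fun c _ hc => ⟨hc.1, hc.2.1⟩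
    · rw [Finset.filter_false_of_mem fun c _ hc => hlong hc.2.2]
      simp
  have hcount : I.card * D ≤ 2 * (H.card * (4 * D)) := by
    calc I.card * D ≤ ∑ c ∈ I, 2 * ∑ e ∈ H with long c e, ((pos e.2).1 - (pos e.1).1) := by
          simpa using Finset.card_nsmul_le_sum I _ D hcover
      _ = 2 * ∑ e ∈ H, ∑ c ∈ I with long c e, ((pos e.2).1 - (pos e.1).1) := by
          simp only [Finset.sum_filter]
          rw [← Finset.mul_sum, Finset.sum_comm]
      _ ≤ 2 * (H.card * (4 * D)) := by
          refine Nat.mul_le_mul_left _ ?_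
          simpa using Finset.sum_le_card_nsmul H _ _ hfew
  have hcard : I.card = (startBox D (2 ^ (k + s))).card * (2 ^ (k + s) * 2 ^ (k + s)) := by
    simp [hI]
  rw [← hcard]
  refine Nat.le_of_mul_le_mul_right (?_ : I.card * D ≤ 8 * H.card * D) hD0
  linarith

lemma card_latticeBox (D N : ℕ) :
    (latticeBox D N).card = (D + 1) * (4 * D * N * (2 * D * (2 * D))) := by
  simp [latticeBox]

lemma rpow_card_latticeBox_le (k s : ℕ) :
    ((latticeBox (4 ^ k) (2 ^ (k + s))).card : ℝ) ^ ((2 : ℝ) / 9) ≤ 32 * 2 ^ s * 4 ^ k := by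
  have h1 : (latticeBox (4 ^ k) (2 ^ (k + s))).card ≤ 32 * 2 ^ s * (2 ^ k) ^ 9 := by
    have hD : 1 ≤ 4 ^ k := Nat.one_le_pow _ _ (by norm_num)
    rw [card_latticeBox]
    calc _ ≤ (4 ^ k + 4 ^ k) * (4 * 4 ^ k * 2 ^ (k + s) * (2 * 4 ^ k * (2 * 4 ^ k))) :=
          Nat.mul_le_mul_right _ (by omega)
      _ = _ := by
          rw [show (4 : ℕ) ^ k = (2 ^ k) ^ 2 by rw [← pow_mul, mul_comm, pow_mul]; norm_num]
          ring
  have h2 : ((latticeBox (4 ^ k) (2 ^ (k + s))).card : ℝ) ≤ 32 * 2 ^ s * (2 ^ k) ^ 9 := by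
    exact_mod_cast h1
  have hone : (1 : ℝ) ≤ 32 * 2 ^ s := by
    have : (1 : ℝ) ≤ 2 ^ s := one_le_pow₀ (by norm_num)
    linarith
  calc _ ≤ ((32 * 2 ^ s : ℝ) * (2 ^ k) ^ 9) ^ ((2 : ℝ) / 9) :=
        Real.rpow_le_rpow (by positivity) h2 (by norm_num)
    _ = (32 * 2 ^ s : ℝ) ^ ((2 : ℝ) / 9) * 4 ^ k := by
        rw [Real.mul_rpow (by positivity) (by positivity), ← Real.rpow_natCast _ 9,
          ← Real.rpow_mul (by positivity)]
        norm_num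
        rw [← pow_mul, mul_comm k 2, pow_mul]
        norm_num
    _ ≤ (32 * 2 ^ s : ℝ) ^ (1 : ℝ) * 4 ^ k := by
        gcongr
        norm_num
    _ = _ := by rw [Real.rpow_one]

/-- `Ω(n^{2/9})` diameter lower bound for `O(m)`-size shortcut sets. -/
theorem shortcut_set_lower_bound (c : ℝ) (hc : 0 < c) :
    ∃ c' : ℝ, 0 < c' ∧ ∀ N : ℕ, ∃ n : ℕ, N ≤ n ∧
      ∃ E : Finset (Fin n × Fin n),
        ∀ H : Finset (Fin n × Fin n), (∀ q ∈ H, ReachableOn E q.1 q.2) →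
          (H.card : ℝ) ≤ c * (E.card : ℝ) →
          ∃ s t : Fin n, ReachableOn E s t ∧
            ∀ l : List (Fin n), IsWalkOn (E ∪ H) s t l →
              c' * (n : ℝ) ^ ((2 : ℝ) / 9) < (l.length : ℝ) - 1 := by
  obtain ⟨s, hs⟩ : ∃ s : ℕ, 512 * c < 4 ^ s := pow_unbounded_of_one_lt _ (by norm_num)
  refine ⟨1 / (2 * (16 * 4 ^ s) * (32 * 2 ^ s)), by positivity, fun k => ?_⟩
  classical
  set B := latticeBox (4 ^ k) (2 ^ (k + s)) with hB
  have hBcard := card_latticeBox (4 ^ k) (2 ^ (k + s))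
  have hBpow := rpow_card_latticeBox_le k s
  rw [← hB] at hBcard hBpow
  have hD : 1 ≤ 4 ^ k := Nat.one_le_pow _ _ (by norm_num)
  refine ⟨B.card, ?_, ?_⟩
  · have h1 : k < 4 ^ k := Nat.lt_pow_self (by norm_num)
    have h2 : 1 ≤ 4 * 4 ^ k * 2 ^ (k + s) * (2 * 4 ^ k * (2 * 4 ^ k)) :=
      Nat.one_le_iff_ne_zero.2 (by positivity)
    rw [hBcard]
    nlinarith
  let pos : Fin B.card → ℕ × ℕ × ℕ × ℕ := fun v => (B.equivFin.symm v).1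
  have hpos : Function.Injective pos :=
    Subtype.val_injective.comp B.equivFin.symm.injective
  let E : Finset (Fin B.card × Fin B.card) :=
    univ.filter fun e => LatticeStep (bitRev (k + s)) (pos e.1) (pos e.2)
  have hE : ∀ e, e ∈ E ↔ LatticeStep (bitRev (k + s)) (pos e.1) (pos e.2) := by simp [E]
  refine ⟨E, fun H hH hcard => ?_⟩
  by_contra! hcon
  have hmain := card_criticalPaths_le hpos (fun v => (B.equivFin.symm v).2)
    (fun p hp => ⟨B.equivFin ⟨p, hp⟩, by simp [pos]⟩) hE hH (fun u v huv => ?_)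
  · have hEcard := card_edges_le hpos fun e he => (hE e).1 he
    have hn : B.card ≤ 32 * (4 ^ k) ^ 4 * 2 ^ (k + s) := by
      rw [hBcard]
      calc _ ≤ (4 ^ k + 4 ^ k) * (4 * 4 ^ k * 2 ^ (k + s) * (2 * 4 ^ k * (2 * 4 ^ k))) :=
            Nat.mul_le_mul_right _ (by omega)
        _ = _ := by ring
    have hN : (2 : ℝ) ^ (k + s) * 2 ^ (k + s) = 4 ^ s * 4 ^ k := by
      rw [← mul_pow, pow_add]
      norm_num
      ring
    simp only [startBox, Finset.card_product, Finset.card_range] at hmain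
    have h1 : (2 * 4 ^ k * 2 ^ (k + s) * (4 ^ k * 4 ^ k) * (2 ^ (k + s) * 2 ^ (k + s)) : ℝ) ≤
        8 * H.card := by exact_mod_cast hmain
    have h2 : (E.card : ℝ) ≤ 4 * (32 * (4 ^ k) ^ 4 * 2 ^ (k + s)) := by
      exact_mod_cast hEcard.trans (Nat.mul_le_mul_left 4 hn)
    have h3 : c * (E.card : ℝ) ≤ c * (4 * (32 * (4 ^ k) ^ 4 * 2 ^ (k + s))) :=
      mul_le_mul_of_nonneg_left h2 hc.le
    rw [hN] at h1
    have hP : (0 : ℝ) < 2 * (4 ^ k) ^ 4 * 2 ^ (k + s) := by positivity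
    have h4 : (2 * (4 ^ k) ^ 4 * 2 ^ (k + s) : ℝ) * 4 ^ s ≤
        2 * (4 ^ k) ^ 4 * 2 ^ (k + s) * (512 * c) := by linarith
    exact absurd (le_of_mul_le_mul_left h4 hP) (not_le.2 hs)
  · obtain ⟨l, hl, hlen⟩ := hcon u v huv
    refine ⟨l, hl, ?_⟩
    have hl0 : 1 ≤ l.length := by
      rcases l with _ | ⟨x, l⟩
      · simp [isWalkOn_iff] at hl
      · simp
    have h1 : (l.length : ℝ) - 1 ≤ 1 / (2 * (16 * 4 ^ s) * (32 * 2 ^ s)) * (32 * 2 ^ s * 4 ^ k) :=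
      hlen.trans (mul_le_mul_of_nonneg_left hBpow (by positivity))
    have h2 : (2 * (16 * 4 ^ s * ((l.length : ℝ) - 1))) ≤ 4 ^ k := by
      calc _ ≤ 2 * (16 * 4 ^ s * (1 / (2 * (16 * 4 ^ s) * (32 * 2 ^ s)) *
            (32 * 2 ^ s * 4 ^ k))) := by gcongr
        _ = (4 : ℝ) ^ k := by field_simp
    have h3 : ((l.length - 1 : ℕ) : ℝ) = (l.length : ℝ) - 1 := by
      rw [Nat.cast_sub hl0, Nat.cast_one]
    rw [← h3] at h2
    exact_mod_cast h2
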